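/- For every SPARQL expression P, the SPARQL_LD query Q^P (the Linked Data query defined by Q^P(W) = ⟦P⟧_{AllData(W)}) is monotonic if and only if P is monotonic. -/

import Mathlib

/-! Basic vocabulary: pairwise disjoint countably infinite sets of URIs,
blank nodes, literals and variables (realized as constructors of sum-like
inductive types over `ℕ`). -/

abbrev URI := ℕ
abbrev BNode := ℕ
abbrev Lit := ℕ
abbrev Var := ℕ
abbrev Doc := ℕ

/-- RDF terms: elements of U ∪ B ∪ L (pairwise disjoint). -/
inductive Term
  | uri (u : URI)
  | bnode (b : BNode)
  | lit (l : Lit)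

/-- Elements of U ∪ B (possible subjects of RDF triples). -/
inductive Node
  | uri (u : URI)
  | bnode (b : BNode)

def Node.toTerm : Node → Term
  | .uri u => .uri u
  | .bnode b => .bnode b

/-- An RDF triple (s,p,o) ∈ (U ∪ B) × U × (U ∪ B ∪ L). -/
structure RDFTriple where
  s : Node
  p : URI
  o : Term

/-- The RDF terms mentioned in a triple. -/
def RDFTriple.terms (t : RDFTriple) : Set Term :=
  {t.s.toTerm, Term.uri t.p, t.o}

/-- The URIs mentioned in a triple. -/
def RDFTriple.uris (t : RDFTriple) : Set URI :=
  {u | Term.uri u ∈ t.terms}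

/-- The blank nodes mentioned in a set of triples. -/
def bnodesOf (G : Set RDFTriple) : Set BNode :=
  {b | ∃ t ∈ G, Term.bnode b ∈ RDFTriple.terms t}

/-- Subject/predicate position of a triple pattern: V ∪ U. -/
inductive PatSP
  | var (v : Var)
  | uri (u : URI)

/-- Object position of a triple pattern: V ∪ U ∪ L. -/
inductive PatO
  | var (v : Var)
  | uri (u : URI)
  | lit (l : Lit)

/-- A triple pattern: an element of (V ∪ U) × (V ∪ U) × (V ∪ U ∪ L). -/
structure TriplePattern where
  s : PatSP
  p : PatSP
  o : PatO

def PatSP.vars : PatSP → Set Var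
  | .var v => {v}
  | .uri _ => ∅

def PatO.vars : PatO → Set Var
  | .var v => {v}
  | .uri _ => ∅
  | .lit _ => ∅

/-- vars(tp): the variables of a triple pattern. -/
def TriplePattern.vars (tp : TriplePattern) : Set Var :=
  tp.s.vars ∪ tp.p.vars ∪ tp.o.vars

/-- A valuation: a partial map V → U ∪ B ∪ L. -/
def Valu := Var → Option Term

/-- The domain of a valuation. -/
def Valu.dom (μ : Valu) : Set Var := {v | μ v ≠ none}

/-- Two valuations are compatible if they agree on the intersection of their
domains. -/
def Valu.Compatible (μ1 μ2 : Valu) : Prop :=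
  ∀ v t1 t2, μ1 v = some t1 → μ2 v = some t2 → t1 = t2

/-- Union of two (compatible) valuations. -/
def Valu.union (μ1 μ2 : Valu) : Valu :=
  fun v => (μ1 v).orElse (fun _ => μ2 v)

def PatSP.applyS (μ : Valu) : PatSP → Option Node
  | .uri u => some (.uri u)
  | .var v =>
      match μ v with
      | some (.uri u) => some (.uri u)
      | some (.bnode b) => some (.bnode b)
      | _ => none

def PatSP.applyP (μ : Valu) : PatSP → Option URI
  | .uri u => some u
  | .var v =>
      match μ v with
      | some (.uri u) => some u
      | _ => none

def PatO.applyO (μ : Valu) : PatO → Option Term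
  | .uri u => some (.uri u)
  | .lit l => some (.lit l)
  | .var v => μ v

/-- μ[tp]: the RDF triple obtained by applying μ to tp (defined only when all
variables of tp are bound by μ to terms of appropriate kinds). -/
def TriplePattern.apply (μ : Valu) (tp : TriplePattern) : Option RDFTriple :=
  match tp.s.applyS μ, tp.p.applyP μ, tp.o.applyO μ with
  | some s, some p, some o => some ⟨s, p, o⟩
  | _, _, _ => none

/-- Constants allowed in filter conditions: U ∪ L. -/
inductive Const
  | uri (u : URI)
  | lit (l : Lit)

def Const.toTerm : Const → Term
  | .uri u => .uri u
  | .lit l => .lit l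

/-- Filter conditions, built from atoms ?x = c, ?x = ?y, bound(?x)
using ¬, ∧, ∨. -/
inductive FilterCond
  | eqConst (v : Var) (c : Const)
  | eqVar (v1 v2 : Var)
  | bound (v : Var)
  | not (R : FilterCond)
  | and (R1 R2 : FilterCond)
  | or (R1 R2 : FilterCond)

/-- μ satisfies a filter condition R. -/
def FilterCond.Satisfies : FilterCond → Valu → Prop
  | .eqConst v c, μ => μ v = some c.toTerm
  | .eqVar v1 v2, μ => ∃ t, μ v1 = some t ∧ μ v2 = some t
  | .bound v, μ => μ v ≠ none
  | .not R, μ => ¬ FilterCond.Satisfies R μ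
  | .and R1 R2, μ => FilterCond.Satisfies R1 μ ∧ FilterCond.Satisfies R2 μ
  | .or R1 R2, μ => FilterCond.Satisfies R1 μ ∨ FilterCond.Satisfies R2 μ

/-- SPARQL expressions. -/
inductive SparqlExpr
  | pat (tp : TriplePattern)
  | andE (P1 P2 : SparqlExpr)
  | unionE (P1 P2 : SparqlExpr)
  | optE (P1 P2 : SparqlExpr)
  | filterE (P : SparqlExpr) (R : FilterCond)

/-- ⟦P⟧_G : the evaluation of a SPARQL expression P over a (possibly infinite)
set G of RDF triples. -/
def eval : SparqlExpr → Set RDFTriple → Set Valu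
  | .pat tp, G =>
      {μ | Valu.dom μ = tp.vars ∧ ∃ t ∈ G, TriplePattern.apply μ tp = some t}
  | .andE P1 P2, G =>
      {μ | ∃ μ1 ∈ eval P1 G, ∃ μ2 ∈ eval P2 G,
        Valu.Compatible μ1 μ2 ∧ μ = Valu.union μ1 μ2}
  | .unionE P1 P2, G => eval P1 G ∪ eval P2 G
  | .optE P1 P2, G =>
      {μ | ∃ μ1 ∈ eval P1 G, ∃ μ2 ∈ eval P2 G,
        Valu.Compatible μ1 μ2 ∧ μ = Valu.union μ1 μ2} ∪
      {μ1 | μ1 ∈ eval P1 G ∧ ∀ μ2 ∈ eval P2 G, ¬ Valu.Compatible μ1 μ2}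
  | .filterE P R, G => {μ | μ ∈ eval P G ∧ FilterCond.Satisfies R μ}

/-- P is satisfiable: ⟦P⟧_G ≠ ∅ for some set G of RDF triples. -/
def SparqlExpr.Satisfiable (P : SparqlExpr) : Prop :=
  ∃ G : Set RDFTriple, (eval P G).Nonempty

/-- P is nontrivially satisfiable: some solution binds at least one variable. -/
def SparqlExpr.NontriviallySatisfiable (P : SparqlExpr) : Prop :=
  ∃ G : Set RDFTriple, ∃ μ ∈ eval P G, Valu.dom μ ≠ ∅

/-- P is monotonic: G1 ⊆ G2 implies ⟦P⟧_{G1} ⊆ ⟦P⟧_{G2}. -/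
def SparqlExpr.Monotonic (P : SparqlExpr) : Prop :=
  ∀ G1 G2 : Set RDFTriple, G1 ⊆ G2 → eval P G1 ⊆ eval P G2

/-- A Web of Linked Data W = (D, data, adoc): D a countable set of LD documents
(subsets of ℕ are countable), data assigns to each document a finite set of
RDF triples (distinct documents using disjoint sets of blank nodes), and adoc
is a partial surjective map from URIs to D. -/
structure Web where
  D : Set Doc
  data : Doc → Set RDFTriple
  adoc : URI → Option Doc
  data_fin : ∀ d ∈ D, (data d).Finite
  bnode_disj : ∀ d1 ∈ D, ∀ d2 ∈ D, d1 ≠ d2 →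
    Disjoint (bnodesOf (data d1)) (bnodesOf (data d2))
  adoc_mem : ∀ u d, adoc u = some d → d ∈ D
  adoc_surj : ∀ d ∈ D, ∃ u, adoc u = some d

/-- AllData(W) = ⋃_{d ∈ D} data(d). -/
def Web.AllData (W : Web) : Set RDFTriple := ⋃ d ∈ W.D, W.data d

/-- A Web of Linked Data is finite iff its set of documents is finite. -/
def Web.IsFinite (W : Web) : Prop := W.D.Finite

/-- W1 is an induced subweb of W2. -/
def InducedSubweb (W1 W2 : Web) : Prop :=
  W1.D ⊆ W2.D ∧ (∀ d ∈ W1.D, W1.data d = W2.data d) ∧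
  ∀ u d, W1.adoc u = some d ↔ (W2.adoc u = some d ∧ d ∈ W1.D)

/-- A Linked Data query: a function from Webs of Linked Data to sets of
valuations. -/
def LDQuery := Web → Set Valu

def LDQuery.Satisfiable (q : LDQuery) : Prop := ∃ W, (q W).Nonempty

def LDQuery.NontriviallySatisfiable (q : LDQuery) : Prop :=
  ∃ W, ∃ μ ∈ q W, Valu.dom μ ≠ ∅

def LDQuery.Monotonic (q : LDQuery) : Prop :=
  ∀ W1 W2, InducedSubweb W1 W2 → q W1 ⊆ q W2

/-- The SPARQL_LD (full-Web semantics) query Q^P. -/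
def fullWebQuery (P : SparqlExpr) : LDQuery := fun W => eval P (Web.AllData W)

/-- A reachability criterion. -/
def ReachCrit := RDFTriple → URI → SparqlExpr → Bool

/-- c_None : the reachability criterion that always returns false. -/
def cNone : ReachCrit := fun _ _ _ => false

/-- c1 is less restrictive than c2. -/
def LessRestrictive (c1 c2 : ReachCrit) : Prop :=
  ∀ t u P, c2 t u P = true → c1 t u P = true

/-- A document d is (c,P)-reachable from S in W. -/
inductive Reachable (W : Web) (S : Set URI) (c : ReachCrit) (P : SparqlExpr) : Doc → Prop
  | seed {u : URI} {d : Doc} (hu : u ∈ S) (ha : W.adoc u = some d) :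
      Reachable W S c P d
  | step {d' : Doc} {t : RDFTriple} {u : URI} {d : Doc}
      (hr : Reachable W S c P d') (ht : t ∈ W.data d') (hu : u ∈ RDFTriple.uris t)
      (hc : c t u P = true) (ha : W.adoc u = some d) :
      Reachable W S c P d

lemma Reachable.mem_D {W : Web} {S : Set URI} {c : ReachCrit} {P : SparqlExpr}
    {d : Doc} (h : Reachable W S c P d) : d ∈ W.D := by
  cases h with
  | seed hu ha => exact W.adoc_mem _ _ ha
  | step hr ht hu hc ha => exact W.adoc_mem _ _ ha

lemma Reachable.exists_uri {W : Web} {S : Set URI} {c : ReachCrit} {P : SparqlExpr}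
    {d : Doc} (h : Reachable W S c P d) : ∃ u, W.adoc u = some d := by
  cases h with
  | seed hu ha => exact ⟨_, ha⟩
  | step hr ht hu hc ha => exact ⟨_, ha⟩

open Classical in
/-- The restriction of adoc to URIs whose document lies in `Ds`. -/
noncomputable def restrictAdoc (W : Web) (Ds : Set Doc) : URI → Option Doc :=
  fun u => if (∃ d ∈ Ds, W.adoc u = some d) then W.adoc u else none

lemma restrictAdoc_eq_some (W : Web) (Ds : Set Doc) (u : URI) (d : Doc) :
    restrictAdoc W Ds u = some d ↔ W.adoc u = some d ∧ d ∈ Ds := by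
  unfold restrictAdoc
  split
  · rename_i h
    obtain ⟨d', hd', ha⟩ := h
    constructor
    · intro he
      obtain rfl : d = d' := Option.some.inj (he.symm.trans ha)
      exact ⟨he, hd'⟩
    · exact fun h => h.1
  · rename_i h
    push_neg at h
    constructor
    · intro he; cases he
    · rintro ⟨he, hd⟩
      exact (h d hd he).elim

/-- The (S,c,P)-reachable part of W: the induced subweb of W whose documents
are exactly those (c,P)-reachable from S in W. -/
noncomputable def reachablePart (W : Web) (S : Set URI) (c : ReachCrit)
    (P : SparqlExpr) : Web where
  D := {d | Reachable W S c P d}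
  data := W.data
  adoc := restrictAdoc W {d | Reachable W S c P d}
  data_fin := fun d hd => W.data_fin d (Reachable.mem_D hd)
  bnode_disj := fun d1 h1 d2 h2 hne =>
    W.bnode_disj d1 (Reachable.mem_D h1) d2 (Reachable.mem_D h2) hne
  adoc_mem := fun u d h => ((restrictAdoc_eq_some W _ u d).mp h).2
  adoc_surj := fun d hd => by
    obtain ⟨u, hu⟩ := Reachable.exists_uri hd
    exact ⟨u, (restrictAdoc_eq_some W _ u d).mpr ⟨hu, hd⟩⟩

/-- The SPARQL_LD(R) (reachability-based semantics) query Q^{P,S,c}. -/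
def reachQuery (P : SparqlExpr) (S : Set URI) (c : ReachCrit) : LDQuery :=
  fun W => eval P (Web.AllData (reachablePart W S c P))

/-- A reachability criterion ensures finiteness if every reachable part
(w.r.t. a finite seed set) has finitely many documents. -/
def EnsuresFiniteness (c : ReachCrit) : Prop :=
  ∀ (W : Web) (S : Set URI), S.Finite → ∀ P : SparqlExpr,
    (reachablePart W S c P).D.Finite

/-! Blank nodes are renamed to fresh URIs. Evaluation commutes with this renaming, and a set of
triples without blank nodes can be spread over documents holding one triple each. -/

/-- A strict upper bound for the URIs in a subject or predicate position. -/
def PatSP.uriBound : PatSP → ℕ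
  | .var _ => 0
  | .uri u => u + 1

/-- A strict upper bound for the URIs in an object position. -/
def PatO.uriBound : PatO → ℕ
  | .var _ => 0
  | .uri u => u + 1
  | .lit _ => 0

/-- A strict upper bound for the URIs in a filter condition. -/
def FilterCond.uriBound : FilterCond → ℕ
  | .eqConst _ (.uri u) => u + 1
  | .eqConst _ (.lit _) => 0
  | .eqVar _ _ => 0
  | .bound _ => 0
  | .not R => R.uriBound
  | .and R1 R2 => max R1.uriBound R2.uriBound
  | .or R1 R2 => max R1.uriBound R2.uriBound

/-- A strict upper bound for the URIs in a SPARQL expression. -/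
def SparqlExpr.uriBound : SparqlExpr → ℕ
  | .pat tp => max (max tp.s.uriBound tp.p.uriBound) tp.o.uriBound
  | .andE P1 P2 => max P1.uriBound P2.uriBound
  | .unionE P1 P2 => max P1.uriBound P2.uriBound
  | .optE P1 P2 => max P1.uriBound P2.uriBound
  | .filterE P R => max P.uriBound R.uriBound

/-- An injection of the URIs that fixes those below `N` and avoids the odd numbers above `2 * N`. -/
def shiftURI (N u : ℕ) : ℕ := if u < N then u else 2 * u

/-- Replace blank nodes by URIs, fixing literals and the URIs below `N`. -/
def Term.skolem (N : ℕ) : Term → Term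
  | .uri u => .uri (shiftURI N u)
  | .bnode b => .uri (2 * (N + b) + 1)
  | .lit l => .lit l

/-- Replace blank nodes by URIs, fixing the URIs below `N`. -/
def Node.skolem (N : ℕ) : Node → Node
  | .uri u => .uri (shiftURI N u)
  | .bnode b => .uri (2 * (N + b) + 1)

def RDFTriple.skolem (N : ℕ) (t : RDFTriple) : RDFTriple :=
  ⟨t.s.skolem N, shiftURI N t.p, t.o.skolem N⟩

def Valu.skolem (N : ℕ) (μ : Valu) : Valu := fun v => (μ v).map (Term.skolem N)

lemma Term.skolem_injective (N : ℕ) : Function.Injective (Term.skolem N) := by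
  have uri_uri : ∀ u v : ℕ, shiftURI N u = shiftURI N v → u = v := by
    intro u v h
    unfold shiftURI at h
    split_ifs at h <;> omega
  have uri_bnode : ∀ u b : ℕ, shiftURI N u ≠ 2 * (N + b) + 1 := by
    intro u b h
    unfold shiftURI at h
    split_ifs at h <;> omega
  have bnode_bnode : ∀ a b : ℕ, 2 * (N + a) + 1 = 2 * (N + b) + 1 → a = b := by omega
  rintro (u | a | l) (v | b | m) h <;>
    simp only [Term.skolem, Term.uri.injEq, reduceCtorEq] at h
  · rw [uri_uri u v h]
  · exact (uri_bnode u b h).elim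
  · exact (uri_bnode v a h.symm).elim
  · rw [bnode_bnode a b h]
  · exact h

lemma Node.toTerm_skolem (N : ℕ) (n : Node) : (n.skolem N).toTerm = n.toTerm.skolem N := by
  cases n <;> rfl

lemma Valu.skolem_injective (N : ℕ) : Function.Injective (Valu.skolem N) := fun _ _ h =>
  funext fun v => Option.map_injective (Term.skolem_injective N) (congrFun h v)

lemma Valu.dom_skolem (N : ℕ) (μ : Valu) : (μ.skolem N).dom = μ.dom := by
  ext v
  simp [Valu.dom, Valu.skolem]

lemma Valu.skolem_union (N : ℕ) (μ₁ μ₂ : Valu) :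
    (μ₁.union μ₂).skolem N = (μ₁.skolem N).union (μ₂.skolem N) := by
  funext v
  simp only [Valu.skolem, Valu.union]
  cases μ₁ v <;> rfl

lemma Valu.compatible_skolem_iff (N : ℕ) (μ₁ μ₂ : Valu) :
    (μ₁.skolem N).Compatible (μ₂.skolem N) ↔ μ₁.Compatible μ₂ := by
  refine forall_congr' fun v => ?_
  simp only [Valu.skolem]
  cases μ₁ v <;> cases μ₂ v <;> simp [(Term.skolem_injective N).eq_iff]

lemma FilterCond.satisfies_skolem_iff {N : ℕ} (R : FilterCond) (hR : R.uriBound ≤ N) (μ : Valu) :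
    R.Satisfies (μ.skolem N) ↔ R.Satisfies μ := by
  induction R with
  | eqConst v c =>
    have hc : c.toTerm = c.toTerm.skolem N := by
      cases c with
      | uri u => simp [Const.toTerm, Term.skolem, shiftURI, show u < N from hR]
      | lit l => rfl
    simp only [FilterCond.Satisfies, Valu.skolem]
    conv_lhs => rw [hc, ← Option.map_some, (Option.map_injective (Term.skolem_injective N)).eq_iff]
  | eqVar v w =>
    simp only [FilterCond.Satisfies, Valu.skolem]
    cases μ v <;> cases μ w <;> simp [(Term.skolem_injective N).eq_iff]
  | bound v => simp [FilterCond.Satisfies, Valu.skolem]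
  | not R ih => exact not_congr (ih hR)
  | and R₁ R₂ ih₁ ih₂ =>
    exact and_congr (ih₁ (max_le_iff.mp hR).1) (ih₂ (max_le_iff.mp hR).2)
  | or R₁ R₂ ih₁ ih₂ =>
    exact or_congr (ih₁ (max_le_iff.mp hR).1) (ih₂ (max_le_iff.mp hR).2)

/-- The term that a valuation assigns to a subject or predicate position, of whatever kind. -/
def PatSP.value (μ : Valu) : PatSP → Option Term
  | .uri u => some (.uri u)
  | .var v => μ v

lemma PatSP.applyS_eq_some_iff (μ : Valu) (x : PatSP) (n : Node) :
    x.applyS μ = some n ↔ x.value μ = some n.toTerm := by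
  cases x with
  | uri u => cases n <;> simp [PatSP.applyS, PatSP.value, Node.toTerm]
  | var v =>
    simp only [PatSP.applyS, PatSP.value]
    rcases μ v with _ | _ | _ | _ <;> cases n <;> simp [Node.toTerm]

lemma PatSP.applyP_eq_some_iff (μ : Valu) (x : PatSP) (p : URI) :
    x.applyP μ = some p ↔ x.value μ = some (.uri p) := by
  cases x with
  | uri u => simp [PatSP.applyP, PatSP.value]
  | var v =>
    simp only [PatSP.applyP, PatSP.value]
    rcases μ v with _ | _ | _ | _ <;> simp

lemma TriplePattern.apply_eq_some_iff (μ : Valu) (tp : TriplePattern) (t : RDFTriple) :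
    tp.apply μ = some t ↔
      tp.s.value μ = some t.s.toTerm ∧ tp.p.value μ = some (.uri t.p) ∧
        tp.o.applyO μ = some t.o := by
  rw [← PatSP.applyS_eq_some_iff, ← PatSP.applyP_eq_some_iff]
  obtain ⟨s, p, o⟩ := t
  simp only [TriplePattern.apply]
  cases tp.s.applyS μ <;> cases tp.p.applyP μ <;> cases tp.o.applyO μ <;> simp

lemma PatSP.value_skolem {N : ℕ} (x : PatSP) (hx : x.uriBound ≤ N) (μ : Valu) :
    x.value (μ.skolem N) = (x.value μ).map (Term.skolem N) := by
  cases x with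
  | uri u => simp [PatSP.value, Term.skolem, shiftURI, show u < N from hx]
  | var v => rfl

lemma PatO.applyO_skolem {N : ℕ} (x : PatO) (hx : x.uriBound ≤ N) (μ : Valu) :
    x.applyO (μ.skolem N) = (x.applyO μ).map (Term.skolem N) := by
  cases x with
  | uri u => simp [PatO.applyO, Term.skolem, shiftURI, show u < N from hx]
  | var v => rfl
  | lit l => rfl

lemma TriplePattern.apply_skolem_iff {N : ℕ} (tp : TriplePattern)
    (htp : (SparqlExpr.pat tp).uriBound ≤ N) (μ : Valu) (t : RDFTriple) :
    tp.apply (μ.skolem N) = some (t.skolem N) ↔ tp.apply μ = some t := by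
  simp only [SparqlExpr.uriBound, max_le_iff] at htp
  obtain ⟨⟨hs, hp⟩, ho⟩ := htp
  have hinj (a b : Option Term) : a.map (Term.skolem N) = b.map (Term.skolem N) ↔ a = b :=
    (Option.map_injective (Term.skolem_injective N)).eq_iff
  have hu : Term.uri (shiftURI N t.p) = (Term.uri t.p).skolem N := rfl
  simp only [TriplePattern.apply_eq_some_iff, RDFTriple.skolem, PatSP.value_skolem _ hs,
    PatSP.value_skolem _ hp, PatO.applyO_skolem _ ho, Node.toTerm_skolem, hu,
    ← Option.map_some (f := Term.skolem N), hinj]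

/-- A solution of a triple pattern over renamed triples is itself a renamed valuation. -/
lemma TriplePattern.exists_skolem_eq {N : ℕ} {tp : TriplePattern} {μ : Valu} {t : RDFTriple}
    (hdom : μ.dom = tp.vars) (ht : tp.apply μ = some (t.skolem N)) :
    ∃ ν : Valu, ν.skolem N = μ := by
  rw [TriplePattern.apply_eq_some_iff] at ht
  obtain ⟨hs, hp, ho⟩ := ht
  have key : ∀ v, ∃ x : Option Term, x.map (Term.skolem N) = μ v := by
    intro v
    by_cases hv : v ∈ tp.vars
    · rcases hv with (hv | hv) | hv
      · refine ⟨some t.s.toTerm, ?_⟩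
        cases h : tp.s <;> rw [h] at hs hv <;> simp only [PatSP.vars] at hv
        · obtain rfl := hv
          exact (hs.trans (congrArg some (Node.toTerm_skolem N t.s))).symm
        · exact hv.elim
      · refine ⟨some (.uri t.p), ?_⟩
        cases h : tp.p <;> rw [h] at hp hv <;> simp only [PatSP.vars] at hv
        · obtain rfl := hv
          exact hp.symm
        · exact hv.elim
      · refine ⟨some t.o, ?_⟩
        cases h : tp.o <;> rw [h] at ho hv <;> simp only [PatO.vars] at hv
        · obtain rfl := hv
          exact ho.symm
        · exact hv.elim
        · exact hv.elim
    · refine ⟨none, ?_⟩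
      rw [← hdom] at hv
      exact (not_not.mp hv).symm
  choose ν hν using key
  exact ⟨ν, funext hν⟩

lemma eval_skolem {N : ℕ} (P : SparqlExpr) (hP : P.uriBound ≤ N) (G : Set RDFTriple) :
    eval P (RDFTriple.skolem N '' G) = Valu.skolem N '' eval P G := by
  have hjoin : ∀ A B : Set Valu,
      {μ | ∃ μ₁ ∈ Valu.skolem N '' A, ∃ μ₂ ∈ Valu.skolem N '' B,
        μ₁.Compatible μ₂ ∧ μ = μ₁.union μ₂} =
      Valu.skolem N '' {μ | ∃ μ₁ ∈ A, ∃ μ₂ ∈ B, μ₁.Compatible μ₂ ∧ μ = μ₁.union μ₂} := by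
    intro A B
    ext μ
    constructor
    · rintro ⟨_, ⟨μ₁, h₁, rfl⟩, _, ⟨μ₂, h₂, rfl⟩, hc, rfl⟩
      exact ⟨_, ⟨μ₁, h₁, μ₂, h₂, (Valu.compatible_skolem_iff N _ _).mp hc, rfl⟩,
        Valu.skolem_union N _ _⟩
    · rintro ⟨_, ⟨μ₁, h₁, μ₂, h₂, hc, rfl⟩, rfl⟩
      exact ⟨_, ⟨μ₁, h₁, rfl⟩, _, ⟨μ₂, h₂, rfl⟩, (Valu.compatible_skolem_iff N _ _).mpr hc,
        Valu.skolem_union N _ _⟩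
  induction P with
  | pat tp =>
    ext μ
    constructor
    · rintro ⟨hdom, _, ⟨t, ht, rfl⟩, happ⟩
      obtain ⟨ν, rfl⟩ := TriplePattern.exists_skolem_eq hdom happ
      exact ⟨ν, ⟨(Valu.dom_skolem N ν).symm.trans hdom, t, ht,
        (tp.apply_skolem_iff hP ν t).mp happ⟩, rfl⟩
    · rintro ⟨ν, ⟨hdom, t, ht, happ⟩, rfl⟩
      exact ⟨(Valu.dom_skolem N ν).trans hdom, _, ⟨t, ht, rfl⟩,
        (tp.apply_skolem_iff hP ν t).mpr happ⟩
  | andE P₁ P₂ ih₁ ih₂ =>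
    rw [eval, eval, ih₁ (max_le_iff.mp hP).1, ih₂ (max_le_iff.mp hP).2, hjoin]
  | unionE P₁ P₂ ih₁ ih₂ =>
    rw [eval, eval, ih₁ (max_le_iff.mp hP).1, ih₂ (max_le_iff.mp hP).2, Set.image_union]
  | optE P₁ P₂ ih₁ ih₂ =>
    rw [eval, eval, ih₁ (max_le_iff.mp hP).1, ih₂ (max_le_iff.mp hP).2, hjoin, Set.image_union]
    congr 1
    ext μ
    constructor
    · rintro ⟨⟨ν, hν, rfl⟩, hc⟩
      exact ⟨ν, ⟨hν, fun μ₂ h₂ h =>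
        hc _ ⟨μ₂, h₂, rfl⟩ ((Valu.compatible_skolem_iff N _ _).mpr h)⟩, rfl⟩
    · rintro ⟨ν, ⟨hν, hc⟩, rfl⟩
      refine ⟨⟨ν, hν, rfl⟩, ?_⟩
      rintro _ ⟨μ₂, h₂, rfl⟩ h
      exact hc μ₂ h₂ ((Valu.compatible_skolem_iff N _ _).mp h)
  | filterE P R ih =>
    rw [eval, eval, ih (max_le_iff.mp hP).1]
    have hR := fun μ => R.satisfies_skolem_iff (max_le_iff.mp hP).2 μ
    ext μ
    constructor
    · rintro ⟨⟨ν, hν, rfl⟩, h⟩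
      exact ⟨ν, ⟨hν, (hR ν).mp h⟩, rfl⟩
    · rintro ⟨ν, ⟨hν, h⟩, rfl⟩
      exact ⟨⟨ν, hν, rfl⟩, (hR ν).mpr h⟩

lemma RDFTriple.bnode_notMem_terms_skolem (N : ℕ) (t : RDFTriple) (b : BNode) :
    Term.bnode b ∉ (t.skolem N).terms := by
  obtain ⟨_ | _, p, _ | _ | _⟩ := t <;>
    simp [RDFTriple.terms, RDFTriple.skolem, Node.skolem, Term.skolem, Node.toTerm]

lemma exists_injective_RDFTriple_nat : ∃ e : RDFTriple → ℕ, Function.Injective e := by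
  let node : Node → ℕ ⊕ ℕ
    | .uri u => .inl u
    | .bnode b => .inr b
  let term : Term → ℕ ⊕ ℕ ⊕ ℕ
    | .uri u => .inl u
    | .bnode b => .inr (.inl b)
    | .lit l => .inr (.inr l)
  have hnode : Function.Injective node := by
    rintro (_ | _) (_ | _) h <;> simp_all [node]
  have hterm : Function.Injective term := by
    rintro (_ | _ | _) (_ | _ | _) h <;> simp_all [term]
  refine ⟨fun t => Encodable.encode (node t.s, t.p, term t.o), ?_⟩
  rintro ⟨s, p, o⟩ ⟨s', p', o'⟩ h
  have h' := Encodable.encode_injective h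
  simp only [Prod.mk.injEq] at h'
  rw [hnode h'.1, h'.2.1, hterm h'.2.2]

open Classical in
/-- The Web with one document for each triple in `G`, in which blank nodes are renamed. -/
noncomputable def singletonWeb (e : RDFTriple → ℕ) (he : Function.Injective e) (N : ℕ)
    (G : Set RDFTriple) : Web where
  D := e '' G
  data d := RDFTriple.skolem N '' (e ⁻¹' {d})
  adoc u := if u ∈ e '' G then some u else none
  data_fin d _ := ((Set.finite_singleton d).preimage he.injOn).image _
  bnode_disj := by
    intro d₁ _ d₂ _ _
    rw [Set.disjoint_left]
    rintro b ⟨_, ⟨t, _, rfl⟩, hb⟩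
    exact (RDFTriple.bnode_notMem_terms_skolem N t b hb).elim
  adoc_mem := by
    intro u d h
    split_ifs at h with hu
    exact Option.some.inj h ▸ hu
  adoc_surj d hd := ⟨d, if_pos hd⟩

lemma allData_singletonWeb (e : RDFTriple → ℕ) (he : Function.Injective e) (N : ℕ)
    (G : Set RDFTriple) : (singletonWeb e he N G).AllData = RDFTriple.skolem N '' G := by
  ext t
  simp only [Web.AllData, singletonWeb, Set.mem_iUnion]
  constructor
  · rintro ⟨_, ⟨t₁, h₁, rfl⟩, t₂, h₂, rfl⟩
    exact ⟨t₂, he h₂ ▸ h₁, rfl⟩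
  · rintro ⟨t₁, h₁, rfl⟩
    exact ⟨e t₁, ⟨t₁, h₁, rfl⟩, t₁, rfl, rfl⟩

lemma inducedSubweb_singletonWeb (e : RDFTriple → ℕ) (he : Function.Injective e) (N : ℕ)
    {G₁ G₂ : Set RDFTriple} (h : G₁ ⊆ G₂) :
    InducedSubweb (singletonWeb e he N G₁) (singletonWeb e he N G₂) := by
  refine ⟨Set.image_mono h, fun _ _ => rfl, fun u d => ?_⟩
  simp only [singletonWeb, Option.ite_none_right_eq_some, Option.some.injEq]
  constructor
  · rintro ⟨hu, rfl⟩
    exact ⟨⟨Set.image_mono h hu, rfl⟩, hu⟩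
  · rintro ⟨⟨_, rfl⟩, hd⟩
    exact ⟨hd, rfl⟩

lemma InducedSubweb.allData_subset {W₁ W₂ : Web} (h : InducedSubweb W₁ W₂) :
    W₁.AllData ⊆ W₂.AllData := by
  intro t ht
  simp only [Web.AllData, Set.mem_iUnion] at ht ⊢
  obtain ⟨d, hd, ht⟩ := ht
  exact ⟨d, h.1 hd, h.2.1 d hd ▸ ht⟩

/-- Q^P is monotonic iff P is monotonic. -/
theorem statement_2 (P : SparqlExpr) :
    LDQuery.Monotonic (fullWebQuery P) ↔ P.Monotonic := by
  refine ⟨fun hQ G₁ G₂ hG => ?_, fun hP W₁ W₂ h => hP _ _ h.allData_subset⟩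
  obtain ⟨e, he⟩ := exists_injective_RDFTriple_nat
  have h := hQ _ _ (inducedSubweb_singletonWeb e he P.uriBound hG)
  simp only [fullWebQuery, allData_singletonWeb, eval_skolem P le_rfl] at h
  exact (Set.image_subset_image_iff (Valu.skolem_injective _)).mp h
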